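/- arXiv:1305.1653 — 2 statements merged into one kernel-verified Lean document; each statement's English description precedes it below -/
import Mathlib

section
/- Fix N ≥ 2 and collision parameters (q_n^±). For every continuous function X : ℝ_+ → ℝ^N with X(0) ∈ W_N = {y : y_1 ≤ … ≤ y_N}, there exists a unique system of N competing particles with driving function X and these parameters of collision. -/
open Set

/-- `Y` (with extended vector of collision terms `L`, where component `m : Fin (N+1)`
is the collision term `L_{(m-1,m)}` between particles `m-1` and `m` in `0`-indexed
notation, and the boundary components `0` and `N` vanish identically) is a system of `N`
competing particles with driving function `X` and parameters of collision `qp, qm`. -/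
def IsCompetingParticleSystem (N : ℕ) (qp qm : Fin N → ℝ)
    (X Y : ℝ → Fin N → ℝ) (L : ℝ → Fin (N + 1) → ℝ) : Prop :=
  (∀ k, Continuous fun t => Y t k) ∧
  (∀ m, Continuous fun t => L t m) ∧
  (∀ t : ℝ, 0 ≤ t → Monotone (Y t)) ∧
  (∀ t : ℝ, L t 0 = 0 ∧ L t (Fin.last N) = 0) ∧
  (∀ t : ℝ, 0 ≤ t → ∀ k : Fin N,
    Y t k = X t k + qp k * L t k.castSucc - qm k * L t k.succ) ∧
  (∀ m, L 0 m = 0) ∧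
  (∀ m, MonotoneOn (fun t => L t m) (Ici 0)) ∧
  (∀ (k : Fin N) (hk : (k : ℕ) + 1 < N), ∀ s t : ℝ, 0 ≤ s → s ≤ t →
    (∀ u ∈ Icc s t, Y u k ≠ Y u ⟨(k : ℕ) + 1, hk⟩) → L t k.succ = L s k.succ)

/-- Running supremum of the positive part of `f` over `[0, t]`. -/
noncomputable def runSup (f : ℝ → ℝ) (t : ℝ) : ℝ :=
  sSup (Set.image (fun r : ℝ => max (f (r * max t 0)) 0) (Icc (0:ℝ) 1))

lemma runSup_continuous {f : ℝ → ℝ} (hf : Continuous f) : Continuous (runSup f) := by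
  have h : Continuous (Function.uncurry fun (t r : ℝ) => max (f (r * max t 0)) 0) := by
    unfold Function.uncurry
    fun_prop
  exact IsCompact.continuous_sSup (K := Icc (0:ℝ) 1)
    (f := fun (t r : ℝ) => max (f (r * max t 0)) 0) isCompact_Icc h

lemma runSup_attained {f : ℝ → ℝ} (hf : Continuous f) {t : ℝ} (ht : 0 ≤ t) :
    ∃ s ∈ Icc 0 t, runSup f t = max (f s) 0 := by
  obtain ⟨r, hr, h⟩ := (isCompact_Icc (a := (0:ℝ)) (b := 1)).exists_sSup_image_eq
    (f := fun r : ℝ => max (f (r * max t 0)) 0) ⟨0, by simp⟩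
    (by fun_prop)
  refine ⟨r * max t 0, ?_, h⟩
  rw [max_eq_left ht]
  exact ⟨mul_nonneg hr.1 ht, mul_le_of_le_one_left ht hr.2⟩

lemma max_le_runSup {f : ℝ → ℝ} (hf : Continuous f) {s t : ℝ} (hs : 0 ≤ s) (hst : s ≤ t) :
    max (f s) 0 ≤ runSup f t := by
  have hbdd : BddAbove (Set.image (fun r : ℝ => max (f (r * max t 0)) 0) (Icc (0:ℝ) 1)) :=
    (isCompact_Icc.image (by fun_prop)).bddAbove
  refine le_csSup hbdd ?_
  have ht := hs.trans hst
  rcases ht.eq_or_lt with h | h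
  · refine ⟨0, by simp, ?_⟩
    have : s = 0 := by linarith
    simp [this]
  · refine ⟨s / t, ⟨by positivity, (div_le_one h).2 hst⟩, ?_⟩
    simp only [max_eq_left ht]
    rw [div_mul_cancel₀ _ h.ne']

lemma le_runSup {f : ℝ → ℝ} (hf : Continuous f) {s t : ℝ} (hs : 0 ≤ s) (hst : s ≤ t) :
    f s ≤ runSup f t := (le_max_left _ _).trans (max_le_runSup hf hs hst)

lemma runSup_nonneg {f : ℝ → ℝ} (hf : Continuous f) {t : ℝ} (ht : 0 ≤ t) :
    0 ≤ runSup f t := (le_max_right _ _).trans (max_le_runSup hf ht le_rfl)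

lemma runSup_le {f : ℝ → ℝ} (hf : Continuous f) {t M : ℝ} (ht : 0 ≤ t) (hM : 0 ≤ M)
    (h : ∀ s ∈ Icc 0 t, f s ≤ M) : runSup f t ≤ M := by
  obtain ⟨s, hs, h'⟩ := runSup_attained hf ht
  rw [h']
  exact max_le (h s hs) hM

lemma runSup_mono {f : ℝ → ℝ} (hf : Continuous f) : MonotoneOn (runSup f) (Ici 0) := by
  intro s hs t ht hst
  exact runSup_le hf hs (runSup_nonneg hf ht) fun v hv => le_runSup hf hv.1 (hv.2.trans hst)

lemma runSup_zero {f : ℝ → ℝ} (hf : Continuous f) (h0 : f 0 ≤ 0) : runSup f 0 = 0 := by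
  refine le_antisymm (runSup_le hf le_rfl le_rfl ?_) (runSup_nonneg hf le_rfl)
  intro s hs
  have : s = 0 := le_antisymm hs.2 hs.1
  rwa [this]

lemma runSup_neg (f : ℝ → ℝ) (t : ℝ) : runSup f t = runSup f (max t 0) := by
  simp [runSup]

lemma runSup_le_add {f g : ℝ → ℝ} (hf : Continuous f) (hg : Continuous g) {t d : ℝ}
    (ht : 0 ≤ t) (h : ∀ s ∈ Icc 0 t, |f s - g s| ≤ d) : runSup f t ≤ runSup g t + d := by
  have hd : 0 ≤ d := (abs_nonneg _).trans (h 0 ⟨le_rfl, ht⟩)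
  refine runSup_le hf ht (add_nonneg (runSup_nonneg hg ht) hd) fun s hs => ?_
  have h1 := le_runSup hg hs.1 hs.2
  have h2 := (abs_le.1 (h s hs)).2
  linarith

lemma runSup_lip {f g : ℝ → ℝ} (hf : Continuous f) (hg : Continuous g) {t d : ℝ}
    (ht : 0 ≤ t) (h : ∀ s ∈ Icc 0 t, |f s - g s| ≤ d) : |runSup f t - runSup g t| ≤ d := by
  have h1 := runSup_le_add hf hg ht h
  have h2 := runSup_le_add hg hf ht (d := d) (fun s hs => by rw [abs_sub_comm]; exact h s hs)
  rw [abs_le]; constructor <;> linarith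

lemma runSup_compl {f : ℝ → ℝ} (hf : Continuous f) {s t : ℝ} (hs : 0 ≤ s) (hst : s ≤ t)
    (h : ∀ u ∈ Icc s t, runSup f u ≠ f u) : runSup f t = runSup f s := by
  have ht := hs.trans hst
  by_contra hne
  have hlt : runSup f s < runSup f t :=
    lt_of_le_of_ne (runSup_mono hf hs ht hst) (Ne.symm hne)
  obtain ⟨v, hv, hv'⟩ := runSup_attained hf ht
  have h0 := runSup_nonneg hf hs
  have hfv : runSup f t = f v := by
    rcases le_total (f v) 0 with h1 | h1
    · rw [max_eq_right h1] at hv'; linarith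
    · rw [max_eq_left h1] at hv'; exact hv'
  have hsv : s ≤ v := by
    by_contra hc
    have := le_runSup hf hv.1 (not_le.1 hc).le
    linarith
  refine h v ⟨hsv, hv.2⟩ (le_antisymm ?_ (le_runSup hf hv.1 le_rfl))
  rw [← hfv]
  exact runSup_mono hf hv.1 ht hv.2

lemma runSup_unique {f l : ℝ → ℝ} (hf : Continuous f) (hl : Continuous l) (hl0 : l 0 = 0)
    (hm : MonotoneOn l (Ici 0)) (hge : ∀ t, 0 ≤ t → f t ≤ l t)
    (hc : ∀ s t, 0 ≤ s → s ≤ t → (∀ u ∈ Icc s t, l u ≠ f u) → l t = l s)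
    {t : ℝ} (ht : 0 ≤ t) : l t = runSup f t := by
  have hlt : 0 ≤ l t := by rw [← hl0]; exact hm self_mem_Ici ht ht
  refine le_antisymm ?_ (runSup_le hf ht hlt
    fun s hs => (hge s hs.1).trans (hm hs.1 ht hs.2))
  by_contra hcon
  push Not at hcon
  have h0 := runSup_nonneg hf ht
  obtain ⟨s, hs, hs'⟩ := intermediate_value_Icc ht hl.continuousOn
    (show (runSup f t + l t) / 2 ∈ Icc (l 0) (l t) by
      rw [hl0]; constructor <;> linarith)
  have := hc s t hs.1 hs.2 (fun u hu => by
    have h1 : l s ≤ l u := hm hs.1 (hs.1.trans hu.1) hu.1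
    have h2 := le_runSup hf (hs.1.trans hu.1) hu.2
    intro h3
    linarith)
  linarith

/-- Solutions of the Skorohod problem in the orthant with reflection matrix `I - Q`. -/
def IsSk {ι : Type} [Fintype ι] (Q : ι → ι → ℝ) (W l : ℝ → ι → ℝ) : Prop :=
  (∀ i, Continuous fun t => l t i) ∧ (∀ i, l 0 i = 0) ∧
  (∀ i, MonotoneOn (fun t => l t i) (Ici 0)) ∧
  (∀ t, 0 ≤ t → ∀ i, 0 ≤ W t i + l t i - ∑ j, Q i j * l t j) ∧
  (∀ i s t, 0 ≤ s → s ≤ t →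
    (∀ u ∈ Icc s t, W u i + l u i - ∑ j, Q i j * l u j ≠ 0) → l t i = l s i)

/-- The Picard operator for the Skorohod problem. -/
noncomputable def skMap {ι : Type} [Fintype ι] (Q : ι → ι → ℝ) (W l : ℝ → ι → ℝ) :
    ℝ → ι → ℝ :=
  fun t i => runSup (fun s => (∑ j, Q i j * l s j) - W s i) t

section Sk
variable {ι : Type} [Fintype ι] {Q : ι → ι → ℝ} {W : ℝ → ι → ℝ}

lemma sk_fcont (hW : ∀ i, Continuous fun t => W t i) {l : ℝ → ι → ℝ}
    (hl : ∀ i, Continuous fun t => l t i) (i : ι) :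
    Continuous fun s => (∑ j, Q i j * l s j) - W s i := by
  have := hW i
  exact (continuous_finsetSum _ fun j _ => continuous_const.mul (hl j)).sub this

lemma skMap_cont (hW : ∀ i, Continuous fun t => W t i) {l : ℝ → ι → ℝ}
    (hl : ∀ i, Continuous fun t => l t i) (i : ι) :
    Continuous fun t => skMap Q W l t i :=
  runSup_continuous (sk_fcont hW hl i)

lemma isSk_fix (hW : ∀ i, Continuous fun t => W t i) {l : ℝ → ι → ℝ} (h : IsSk Q W l)
    {t : ℝ} (ht : 0 ≤ t) (i : ι) : l t i = skMap Q W l t i := by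
  obtain ⟨h1, h2, h3, h4, h5⟩ := h
  refine runSup_unique (l := fun t => l t i) (sk_fcont hW h1 i) (h1 i) (h2 i) (h3 i) ?_ ?_ ht
  · intro t ht
    have := h4 t ht i
    linarith
  · intro s t hs hst h
    refine h5 i s t hs hst fun u hu h0 => h u hu ?_
    linarith

lemma isSk_of_fix (hW : ∀ i, Continuous fun t => W t i) (hW0 : ∀ i, 0 ≤ W 0 i)
    {l : ℝ → ι → ℝ} (hl : ∀ i, Continuous fun t => l t i)  (h0 : ∀ i, l 0 i = 0)
    (h : ∀ t, 0 ≤ t → ∀ i, l t i = skMap Q W l t i) : IsSk Q W l := by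
  refine ⟨hl, h0, ?_, ?_, ?_⟩
  · intro i s hs t ht hst
    simp only [h s hs i, h t ht i]
    exact runSup_mono (sk_fcont hW hl i) hs ht hst
  · intro t ht i
    have := le_runSup (sk_fcont (Q := Q) hW hl i) ht le_rfl
    have h2 := h t ht i
    unfold skMap at h2
    linarith
  · intro i s t hs hst hu
    rw [h s hs i, h t (hs.trans hst) i]
    refine runSup_compl (sk_fcont hW hl i) hs hst fun u hu' he => hu u hu' ?_
    have h2 := h u (hs.trans hu'.1) i
    unfold skMap at h2
    linarith

lemma skMap_lip (hQ : ∀ i j, 0 ≤ Q i j) (hW : ∀ i, Continuous fun t => W t i)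
    {l l' : ℝ → ι → ℝ} (hl : ∀ i, Continuous fun t => l t i)
    (hl' : ∀ i, Continuous fun t => l' t i) {d : ι → ℝ} {t : ℝ} (ht : 0 ≤ t)
    (h : ∀ s ∈ Icc 0 t, ∀ i, |l s i - l' s i| ≤ d i) (i : ι) :
    |skMap Q W l t i - skMap Q W l' t i| ≤ ∑ j, Q i j * d j := by
  refine runSup_lip (sk_fcont hW hl i) (sk_fcont hW hl' i) ht fun s hs => ?_
  have : (∑ j, Q i j * l s j) - W s i - ((∑ j, Q i j * l' s j) - W s i)
      = ∑ j, Q i j * (l s j - l' s j) := by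
    simp only [mul_sub, Finset.sum_sub_distrib]; ring
  rw [this]
  refine (Finset.abs_sum_le_sum_abs _ _).trans (Finset.sum_le_sum fun j _ => ?_)
  rw [abs_mul, abs_of_nonneg (hQ i j)]
  exact mul_le_mul_of_nonneg_left (h s hs j) (hQ i j)

lemma sk_weight {u : ι → ℝ} {c : ℝ} (hc : ∀ j, ∑ i, u i * Q i j ≤ c * u j) {d : ι → ℝ}
    (hd : ∀ i, 0 ≤ d i) : ∑ i, u i * ∑ j, Q i j * d j ≤ c * ∑ j, u j * d j := by
  calc ∑ i, u i * ∑ j, Q i j * d j = ∑ j, (∑ i, u i * Q i j) * d j := by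
        simp only [Finset.mul_sum, Finset.sum_mul]
        rw [Finset.sum_comm]
        simp only [mul_assoc]
    _ ≤ ∑ j, (c * u j) * d j :=
        Finset.sum_le_sum fun j _ => mul_le_mul_of_nonneg_right (hc j) (hd j)
    _ = _ := by simp only [Finset.mul_sum, mul_assoc]

lemma exists_bound {g : ℝ → ℝ} (hg : Continuous g) {T : ℝ} (hT : 0 ≤ T) :
    ∃ d, 0 ≤ d ∧ (∃ s ∈ Icc 0 T, d = |g s|) ∧ ∀ s ∈ Icc 0 T, |g s| ≤ d := by
  obtain ⟨x, hx, h⟩ := (isCompact_Icc (a := (0:ℝ)) (b := T)).exists_isMaxOn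
    ⟨0, by simp [hT]⟩ (hg.abs.continuousOn)
  exact ⟨|g x|, abs_nonneg _, ⟨x, hx, rfl⟩, fun s hs => h hs⟩

lemma sk_unique (hQ : ∀ i j, 0 ≤ Q i j) {u : ι → ℝ} (hu : ∀ i, 0 < u i) {c : ℝ} (hc1 : c < 1)
    (hc : ∀ j, ∑ i, u i * Q i j ≤ c * u j) (hW : ∀ i, Continuous fun t => W t i)
    {l l' : ℝ → ι → ℝ} (h : IsSk Q W l) (h' : IsSk Q W l') {T : ℝ} (hT : 0 ≤ T) :
    l' T = l T := by
  have hb := fun i => exists_bound ((h.1 i).sub (h'.1 i)) hT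
  choose d hd0 hdm hd using hb
  simp only [Pi.sub_apply] at hdm hd
  have hle : ∀ i, d i ≤ ∑ j, Q i j * d j := by
    intro i
    obtain ⟨s, hs, hs'⟩ := hdm i
    rw [hs', isSk_fix hW h hs.1, isSk_fix hW h' hs.1]
    exact skMap_lip hQ hW h.1 h'.1 hs.1 (fun v hv j => hd j v ⟨hv.1, hv.2.trans hs.2⟩) i
  have h1 : ∑ i, u i * d i ≤ c * ∑ j, u j * d j :=
    (Finset.sum_le_sum fun i _ => mul_le_mul_of_nonneg_left (hle i) (hu i).le).trans
      (sk_weight hc hd0)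
  have h2 : 0 ≤ ∑ i, u i * d i := Finset.sum_nonneg fun i _ => mul_nonneg (hu i).le (hd0 i)
  have h3 : ∑ i, u i * d i = 0 := by nlinarith
  rw [Finset.sum_eq_zero_iff_of_nonneg (fun i _ => mul_nonneg (hu i).le (hd0 i))] at h3
  funext i
  have h4 : d i = 0 := by
    rcases mul_eq_zero.1 (h3 i (Finset.mem_univ i)) with h | h
    · exact absurd h (hu i).ne'
    · exact h
  have h5 := hd i T ⟨hT, le_rfl⟩
  rw [h4] at h5
  have := abs_nonpos_iff.1 h5
  linarith

lemma sk_exists (hQ : ∀ i j, 0 ≤ Q i j) {u : ι → ℝ} (hu : ∀ i, 0 < u i) {c : ℝ} (hc0 : 0 ≤ c)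
    (hc1 : c < 1)
    (hc : ∀ j, ∑ i, u i * Q i j ≤ c * u j) (hW : ∀ i, Continuous fun t => W t i)
    (hW0 : ∀ i, 0 ≤ W 0 i) : ∃ l, IsSk Q W l := by
  classical
  let it : ℕ → ℝ → ι → ℝ := fun n => (skMap Q W)^[n] (fun _ _ => 0)
  have its : ∀ n, it (n+1) = skMap Q W (it n) := fun n => Function.iterate_succ_apply' _ _ _
  have itc : ∀ n i, Continuous fun t => it n t i := by
    intro n
    induction n with
    | zero => intro i; exact continuous_const
    | succ n ih => intro i; rw [its]; exact skMap_cont hW ih i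
  have itmax : ∀ n t, it n t = it n (max t 0) := by
    intro n t
    cases n with
    | zero => rfl
    | succ n => rw [its]; funext i; exact runSup_neg _ _
  have it0 : ∀ n i, it n 0 i = 0 := by
    intro n
    induction n with
    | zero => intro i; rfl
    | succ n ih =>
      intro i
      rw [its]
      refine runSup_zero (sk_fcont hW (itc n) i) ?_
      simp [ih, hW0]
  have key : ∀ T : ℝ, 0 ≤ T → ∃ A : ℝ, 0 ≤ A ∧ ∀ n, ∃ d : ι → ℝ, (∀ i, 0 ≤ d i) ∧
      ∑ i, u i * d i ≤ A * c ^ n ∧ ∀ s ∈ Icc 0 T, ∀ i, |it (n+1) s i - it n s i| ≤ d i := by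
    intro T hT
    have hb := fun i => exists_bound ((itc 1 i).sub (itc 0 i)) hT
    choose d hd0 hdm hd using hb
    refine ⟨∑ i, u i * d i, Finset.sum_nonneg fun i _ => mul_nonneg (hu i).le (hd0 i), ?_⟩
    intro n
    induction n with
    | zero => exact ⟨d, hd0, by simp, fun s hs i => hd i s hs⟩
    | succ n ih =>
      obtain ⟨e, he0, hes, he⟩ := ih
      refine ⟨fun i => ∑ j, Q i j * e j,
        fun i => Finset.sum_nonneg fun j _ => mul_nonneg (hQ i j) (he0 j), ?_, ?_⟩
      · refine (sk_weight hc he0).trans ?_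
        rw [pow_succ]
        nlinarith
      · intro s hs i
        rw [its (n+1)]
        nth_rewrite 2 [its n]
        exact skMap_lip hQ hW (itc _) (itc _) hs.1
          (fun v hv => he v ⟨hv.1, hv.2.trans hs.2⟩) i
  have key2 : ∀ T : ℝ, 0 ≤ T → ∀ i, ∃ B : ℝ, 0 ≤ B ∧ ∀ n, ∀ s ≤ T,
      dist (it n s i) (it (n+1) s i) ≤ B * c ^ n := by
    intro T hT i
    obtain ⟨A, hA, h⟩ := key T hT
    refine ⟨A / u i, div_nonneg hA (hu i).le, fun n s hs => ?_⟩
    obtain ⟨d, hd0, hds, hd⟩ := h n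
    have h1 := hd (max s 0) ⟨le_max_right _ _, max_le hs hT⟩ i
    rw [← itmax, ← itmax] at h1
    rw [dist_comm, Real.dist_eq]
    refine h1.trans ?_
    have h2 : u i * d i ≤ A * c ^ n :=
      (Finset.single_le_sum (f := fun i => u i * d i)
        (fun i _ => mul_nonneg (hu i).le (hd0 i)) (Finset.mem_univ i)).trans hds
    rw [div_mul_eq_mul_div, le_div_iff₀ (hu i)]
    linarith
  have hlim : ∀ t i, ∃ x, Filter.Tendsto (fun n => it n t i) Filter.atTop (nhds x) := by
    intro t i
    obtain ⟨B, hB, h⟩ := key2 (max t 0) (le_max_right _ _) i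
    exact cauchySeq_tendsto_of_complete
      (cauchySeq_of_le_geometric c B hc1 fun n => h n t (le_max_left _ _))
  choose l hl using hlim
  have key3 : ∀ T : ℝ, 0 ≤ T → ∀ i, ∃ B : ℝ, 0 ≤ B ∧ ∀ n, ∀ s ≤ T,
      |it n s i - l s i| ≤ B * c ^ n := by
    intro T hT i
    obtain ⟨B, hB, h⟩ := key2 T hT i
    refine ⟨B / (1 - c), div_nonneg hB (by linarith), fun n s hs => ?_⟩
    have := dist_le_of_le_geometric_of_tendsto c B hc1 (fun n => h n s hs) (hl s i) n
    rw [Real.dist_eq] at this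
    rwa [div_mul_eq_mul_div]
  have hpow : Filter.Tendsto (fun n : ℕ => c ^ n) Filter.atTop (nhds 0) :=
    tendsto_pow_atTop_nhds_zero_of_lt_one hc0 hc1
  have lc : ∀ i, Continuous fun t => l t i := by
    intro i
    rw [continuous_iff_continuousAt]
    intro t
    obtain ⟨B, hB, h⟩ := key3 (max (t+1) 0) (le_max_right _ _) i
    have hunif : TendstoUniformlyOn (fun n s => it n s i) (fun s => l s i) Filter.atTop
        (Iic (max (t+1) 0)) := by
      rw [Metric.tendstoUniformlyOn_iff]
      intro ε hε
      have hz : Filter.Tendsto (fun n : ℕ => B * c ^ n) Filter.atTop (nhds 0) := by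
        simpa using hpow.const_mul B
      filter_upwards [hz.eventually (gt_mem_nhds hε)] with n hn s hs
      rw [dist_comm, Real.dist_eq]
      exact (h n s hs).trans_lt hn
    have hco := hunif.continuousOn
      (Filter.Eventually.frequently (Filter.Eventually.of_forall fun n => (itc n i).continuousOn))
    exact hco.continuousAt (Iic_mem_nhds (lt_max_of_lt_left (by linarith)))
  refine ⟨l, isSk_of_fix hW hW0 lc ?_ ?_⟩
  · intro i
    refine tendsto_nhds_unique (hl 0 i) ?_
    simp [it0]
  · intro t ht i
    have hB := fun j => key3 t ht j
    choose B hB0 hB using hB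
    have h1 : ∀ n, |it (n+1) t i - skMap Q W l t i| ≤ (∑ j, Q i j * B j) * c ^ n := by
      intro n
      rw [its]
      have := skMap_lip hQ hW (itc n) lc ht (d := fun j => B j * c ^ n)
        (fun s hs j => hB j n s hs.2) i
      refine this.trans (le_of_eq ?_)
      rw [Finset.sum_mul]
      simp only [mul_assoc]
    have h2 : Filter.Tendsto (fun n => it (n+1) t i) Filter.atTop (nhds (skMap Q W l t i)) := by
      rw [tendsto_iff_dist_tendsto_zero]
      refine squeeze_zero (fun _ => dist_nonneg) h1 ?_
      simpa using hpow.const_mul (∑ j, Q i j * B j)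
    exact tendsto_nhds_unique ((Filter.tendsto_add_atTop_iff_nat 1).2 (hl t i)) h2

lemma exists_ratio {u s : ι → ℝ} (hu : ∀ i, 0 < u i) (h : ∀ i, s i < u i) :
    ∃ c : ℝ, 0 ≤ c ∧ c < 1 ∧ ∀ i, s i ≤ c * u i := by
  rcases isEmpty_or_nonempty ι with he | he
  · exact ⟨0, le_rfl, one_pos, fun i => he.elim i⟩
  · obtain ⟨i0, hi0⟩ := Finite.exists_max (fun i => s i / u i)
    refine ⟨max (s i0 / u i0) 0, le_max_right _ _,
      max_lt ((div_lt_one (hu i0)).2 (h i0)) one_pos, fun i => ?_⟩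
    rw [← div_le_iff₀ (hu i)]
    exact (hi0 i).trans (le_max_left _ _)

end Sk

/-- The off-diagonal part of the reflection matrix of the gap process. -/
noncomputable def cpQ (n : ℕ) (qp qm : Fin (n+2) → ℝ) (i j : Fin (n+1)) : ℝ :=
  (if (j:ℕ) = i + 1 then qm i.succ else 0) + (if (i:ℕ) = j + 1 then qp i.castSucc else 0)

lemma cpQ_row {n : ℕ} (qp qm : Fin (n+2) → ℝ) (L : Fin (n+3) → ℝ) (h0 : L 0 = 0)
    (h1 : L (Fin.last (n+2)) = 0) (i : Fin (n+1)) :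
    ∑ j, cpQ n qp qm i j * L j.castSucc.succ
      = qm i.succ * L i.succ.succ + qp i.castSucc * L i.castSucc.castSucc := by
  simp only [cpQ, add_mul, Finset.sum_add_distrib]
  congr 1
  · by_cases h : (i:ℕ) + 1 < n + 1
    · rw [Finset.sum_eq_single (⟨i+1, h⟩ : Fin (n+1))]
      · simp only [if_true]
        rfl
      · intro b _ hb
        rw [if_neg, zero_mul]
        intro h'
        exact hb (Fin.ext h')
      · simp
    · have : i.succ.succ = Fin.last (n+2) := by
        ext; simp; omega
      rw [this, h1, mul_zero]
      refine Finset.sum_eq_zero fun j _ => ?_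
      rw [if_neg (by omega), zero_mul]
  · by_cases h : 1 ≤ (i:ℕ)
    · rw [Finset.sum_eq_single (⟨i-1, by omega⟩ : Fin (n+1))]
      · rw [if_pos (by simp; omega)]
        congr 2
        ext; simp; omega
      · intro b _ hb
        rw [if_neg, zero_mul]
        intro h'
        exact hb (Fin.ext (by simp; omega))
      · simp
    · have : i.castSucc.castSucc = 0 := by
        apply Fin.ext
        change (i:ℕ) = 0
        omega
      rw [this, h0, mul_zero]
      refine Finset.sum_eq_zero fun j _ => ?_
      rw [if_neg (by omega), zero_mul]

lemma sum_ite_le {m : ℕ} (p : Fin m → Prop) [DecidablePred p] (f : Fin m → ℝ) (a : ℝ) (ha : 0 ≤ a)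
    (hp : ∀ i j, p i → p j → i = j) (hf : ∀ i, p i → f i ≤ a) :
    ∑ i, (if p i then f i else 0) ≤ a := by
  by_cases h : ∃ i, p i
  · obtain ⟨i, hi⟩ := h
    rw [Finset.sum_eq_single i]
    · rw [if_pos hi]; exact hf i hi
    · intro b _ hb
      rw [if_neg]
      intro h'
      exact hb (hp _ _ h' hi)
    · simp
  · push Not at h
    simp [h, ha]

lemma cpQ_col {n : ℕ} (qp qm : Fin (n+2) → ℝ)
    (hq : ∀ k, 0 < qp k ∧ qp k < 1 ∧ 0 < qm k ∧ qm k < 1)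
    (hrel : ∀ j : Fin (n+1), qp j.succ + qm j.castSucc = 1) :
    ∃ u : Fin (n+1) → ℝ, (∀ i, 0 < u i) ∧ ∀ j, ∑ i, u i * cpQ n qp qm i j < u j := by
  obtain ⟨k0, hk0⟩ := Finite.exists_min qm
  set e := qm k0 with he
  have he0 : 0 < e := (hq k0).2.2.1
  have he1 : e < 1 := (hq k0).2.2.2
  have hpw : ∀ m : ℕ, 0 < e ^ m ∧ e ^ m ≤ 1 := fun m =>
    ⟨pow_pos he0 m, pow_le_one₀ he0.le he1.le⟩
  refine ⟨fun i => 2 - e ^ ((i:ℕ)+1), fun i => by have := hpw (i+1); linarith, fun j => ?_⟩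
  have hsplit : ∀ i : Fin (n+1), (2 - e ^ ((i:ℕ)+1)) * cpQ n qp qm i j
      = (if (j:ℕ) = i + 1 then (2 - e ^ ((i:ℕ)+1)) * qm i.succ else 0)
      + (if (i:ℕ) = j + 1 then (2 - e ^ ((i:ℕ)+1)) * qp i.castSucc else 0) := by
    intro i
    simp only [cpQ, mul_add, mul_ite, mul_zero]
  simp only [hsplit, Finset.sum_add_distrib]
  have a1 := hpw j
  have a2 := hpw (j+2)
  have hA : ∑ i : Fin (n+1), (if (j:ℕ) = i + 1 then (2 - e ^ ((i:ℕ)+1)) * qm i.succ else 0)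
      ≤ (2 - e ^ (j:ℕ)) * qm j.castSucc := by
    refine sum_ite_le _ _ _ (mul_nonneg (by linarith) (hq _).2.2.1.le) ?_ ?_
    · intro i k hi hk; ext; omega
    · intro i hi
      have : i.succ = j.castSucc := by ext; simp; omega
      rw [this, hi]
  have hB : ∑ i : Fin (n+1), (if (i:ℕ) = j + 1 then (2 - e ^ ((i:ℕ)+1)) * qp i.castSucc else 0)
      ≤ (2 - e ^ ((j:ℕ)+2)) * qp j.succ := by
    refine sum_ite_le _ _ _ (mul_nonneg (by linarith) (hq _).1.le) ?_ ?_
    · intro i k hi hk; ext; omega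
    · intro i hi
      have : i.castSucc = j.succ := by ext; simp; omega
      rw [this, hi]
  refine (add_le_add hA hB).trans_lt ?_
  have hr := hrel j
  have hp : qp j.succ = 1 - qm j.castSucc := by linarith
  have hm := hk0 j.castSucc
  have hm1 := (hq j.castSucc).2.2.2
  set p := qm j.castSucc
  set x := e ^ (j:ℕ)
  rw [hp]
  have e1 : e ^ ((j:ℕ)+1) = x * e := pow_succ _ _
  have e2 : e ^ ((j:ℕ)+2) = x * e * e := by rw [pow_succ, pow_succ]
  rw [e1, e2]
  have hpos : 0 < p - (1 - p) * e := by nlinarith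
  have : 0 < x * (1 - e) * (p - (1 - p) * e) :=
    mul_pos (mul_pos a1.1 (by linarith)) hpos
  nlinarith

/-- Extension of interior collision terms by zero at the boundary. -/
noncomputable def cpExt {n : ℕ} (l : Fin (n+1) → ℝ) (m : Fin (n+3)) : ℝ :=
  if h : 1 ≤ (m:ℕ) ∧ (m:ℕ) ≤ n + 1 then l ⟨m - 1, by omega⟩ else 0

lemma cpExt_int {n : ℕ} (l : Fin (n+1) → ℝ) (i : Fin (n+1)) : cpExt l i.castSucc.succ = l i := by
  unfold cpExt
  rw [dif_pos (by simp; omega)]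
  congr 1

lemma fin_cases3 {n : ℕ} (m : Fin (n+3)) :
    m = 0 ∨ m = Fin.last (n+2) ∨ ∃ i : Fin (n+1), m = i.castSucc.succ := by
  by_cases h : m = 0
  · exact Or.inl h
  by_cases h' : m = Fin.last (n+2)
  · exact Or.inr (Or.inl h')
  · have h1 : (m:ℕ) ≠ 0 := fun hh => h (Fin.ext hh)
    have h2 : (m:ℕ) ≠ n + 2 := fun hh => h' (Fin.ext hh)
    refine Or.inr (Or.inr ⟨⟨m - 1, by omega⟩, ?_⟩)
    ext; simp; omega

/-- Gap identity. -/
lemma cp_gap {n : ℕ} {qp qm : Fin (n+2) → ℝ}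
    (hrel : ∀ j : Fin (n+1), qp j.succ + qm j.castSucc = 1)
    {x y : Fin (n+2) → ℝ} {L : Fin (n+3) → ℝ} (h0 : L 0 = 0)
    (h1 : L (Fin.last (n+2)) = 0)
    (hy : ∀ k, y k = x k + qp k * L k.castSucc - qm k * L k.succ) (i : Fin (n+1)) :
    y i.succ - y i.castSucc = (x i.succ - x i.castSucc) + L i.castSucc.succ
      - ∑ j, cpQ n qp qm i j * L j.castSucc.succ := by
  rw [cpQ_row qp qm L h0 h1, hy, hy]
  have h : i.succ.castSucc = i.castSucc.succ := rfl
  have hr : qp i.succ = 1 - qm i.castSucc := by linarith [hrel i]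
  rw [h, hr]
  ring

/-- Existence and uniqueness for systems of competing particles: for every continuous
driving function `X` with ordered initial value `X(0) ∈ W_N`, there exists a unique system
of `N` competing particles with driving function `X` and the given collision parameters. -/
theorem stmt12 (N : ℕ) (hN : 2 ≤ N) (qp qm : Fin N → ℝ)
    (hq : ∀ k, 0 < qp k ∧ qp k < 1 ∧ 0 < qm k ∧ qm k < 1)
    (hrel : ∀ (k : Fin N) (hk : (k : ℕ) + 1 < N), qp ⟨(k : ℕ) + 1, hk⟩ + qm k = 1)
    (X : ℝ → Fin N → ℝ) (hX : ∀ k, Continuous fun t => X t k) (hX0 : Monotone (X 0)) :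
    ∃ (Y : ℝ → Fin N → ℝ) (L : ℝ → Fin (N + 1) → ℝ),
      IsCompetingParticleSystem N qp qm X Y L ∧
      ∀ (Y' : ℝ → Fin N → ℝ) (L' : ℝ → Fin (N + 1) → ℝ),
        IsCompetingParticleSystem N qp qm X Y' L' →
        ∀ t : ℝ, 0 ≤ t → Y' t = Y t ∧ L' t = L t := by
  obtain ⟨n, rfl⟩ : ∃ n, N = n + 2 := ⟨N - 2, by omega⟩
  have hrel' : ∀ j : Fin (n+1), qp j.succ + qm j.castSucc = 1 := fun j =>
    hrel j.castSucc (by simp; omega)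
  obtain ⟨u, hu, hcol⟩ := cpQ_col qp qm hq hrel'
  obtain ⟨c, hc0, hc1, hc⟩ := exists_ratio hu hcol
  have hQ : ∀ i j, 0 ≤ cpQ n qp qm i j := by
    intro i j
    have h1 := (hq i.succ).2.2.1.le
    have h2 := (hq i.castSucc).1.le
    unfold cpQ
    apply add_nonneg <;> split_ifs <;> simp [h1, h2]
  let W : ℝ → Fin (n+1) → ℝ := fun t i => X t i.succ - X t i.castSucc
  have hW : ∀ i, Continuous fun t => W t i := fun i => (hX _).sub (hX _)
  have hW0 : ∀ i, 0 ≤ W 0 i := fun i => sub_nonneg.2 (hX0 i.castSucc_lt_succ.le)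
  obtain ⟨l, hl⟩ := sk_exists hQ hu hc0 hc1 hc hW hW0
  let L : ℝ → Fin (n+3) → ℝ := fun t => cpExt (l t)
  have hL0 : ∀ t, L t 0 = 0 := fun t => by simp [L, cpExt]
  have hL1 : ∀ t, L t (Fin.last (n+2)) = 0 := fun t => by simp [L, cpExt]
  have hLi : ∀ t i, L t (Fin.succ (Fin.castSucc i)) = l t i := fun t i => cpExt_int _ _
  let Y : ℝ → Fin (n+2) → ℝ := fun t k =>
    X t k + qp k * L t k.castSucc - qm k * L t k.succ
  have hLc : ∀ m, Continuous fun t => L t m := by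
    intro m
    rcases fin_cases3 m with rfl | rfl | ⟨i, rfl⟩
    · simp only [hL0]; exact continuous_const
    · simp only [hL1]; exact continuous_const
    · simp only [hLi]; exact hl.1 i
  have hgap : ∀ t i, Y t (Fin.succ i) - Y t (Fin.castSucc i)
      = W t i + l t i - ∑ j, cpQ n qp qm i j * l t j := by
    intro t i
    have := cp_gap hrel' (hL0 t) (hL1 t) (x := X t) (y := Y t) (fun k => rfl) i
    simpa only [hLi] using this
  refine ⟨Y, L, ⟨?_, hLc, ?_, fun t => ⟨hL0 t, hL1 t⟩, fun t _ k => rfl, ?_, ?_, ?_⟩, ?_⟩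
  · intro k
    exact ((hX k).add (continuous_const.mul (hLc _))).sub (continuous_const.mul (hLc _))
  · intro t ht
    rw [Fin.monotone_iff_le_succ]
    intro i
    have := hl.2.2.2.1 t ht i
    rw [← hgap] at this
    linarith
  · intro m
    rcases fin_cases3 m with rfl | rfl | ⟨i, rfl⟩
    · exact hL0 0
    · exact hL1 0
    · rw [hLi]; exact hl.2.1 i
  · intro m
    rcases fin_cases3 m with rfl | rfl | ⟨i, rfl⟩
    · simp only [hL0]; exact monotoneOn_const
    · simp only [hL1]; exact monotoneOn_const
    · simp only [hLi]; exact hl.2.2.1 i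
  · intro k hk s t hs hst h
    obtain ⟨i, rfl⟩ : ∃ i : Fin (n+1), k = i.castSucc := ⟨⟨k, by omega⟩, rfl⟩
    rw [hLi, hLi]
    refine hl.2.2.2.2 i s t hs hst fun v hv h0 => h v hv ?_
    rw [← hgap] at h0
    exact (sub_eq_zero.1 h0).symm
  · rintro Y' L' ⟨h1, h2, h3, h4, h5, h6, h7, h8⟩ t ht
    have hgap' : ∀ t, 0 ≤ t → ∀ i : Fin (n+1), Y' t i.succ - Y' t i.castSucc
        = W t i + L' t i.castSucc.succ
          - ∑ j : Fin (n+1), cpQ n qp qm i j * L' t j.castSucc.succ :=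
      fun t ht i => cp_gap hrel' (h4 t).1 (h4 t).2 (h5 t ht) i
    have hsk : IsSk (cpQ n qp qm) W (fun t i => L' t i.castSucc.succ) := by
      refine ⟨fun i => h2 _, fun i => h6 _, fun i => h7 _, ?_, ?_⟩
      · intro t ht i
        simp only
        rw [← hgap' t ht i]
        exact sub_nonneg.2 (h3 t ht i.castSucc_lt_succ.le)
      · intro i s t hs hst h
        refine h8 i.castSucc (by simp; omega) s t hs hst fun v hv h0 => h v hv ?_
        simp only
        rw [← hgap' v (hs.trans hv.1) i]
        exact sub_eq_zero.2 h0.symm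
    have heq := sk_unique hQ hu hc1 hc hW hl hsk ht
    have hLL : L' t = L t := by
      funext m
      rcases fin_cases3 m with rfl | rfl | ⟨i, rfl⟩
      · rw [hL0]; exact (h4 t).1
      · rw [hL1]; exact (h4 t).2
      · rw [hLi]; exact congrFun heq i
    refine ⟨?_, hLL⟩
    funext k
    rw [h5 t ht k, hLL]
end

section
/- Let Y be a system of N competing particles with driving function X and collision parameters (q_k^±), and gap process Z_k = Y_{k+1} − Y_k, k = 1,…,N−1. Then Z is the solution of the Skorohod problem in ℝ_+^{N−1} with driving function (X_2 − X_1, …, X_N − X_{N−1})' and reflection matrix R, the tridiagonal matrix with 1's on the diagonal, −q_{k+1}^- on the superdiagonal in row k, and −q_{k+1}^+ on the subdiagonal in row k+1; moreover this matrix R is a reflection nonsingular M-matrix. -/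
open Set

/-- A reflection nonsingular M-matrix: `R = I - Q` with `Q ≥ 0` entrywise, zero diagonal,
and spectral radius strictly less than `1`. -/
def IsReflMMatrix {n : Type*} [Fintype n] [DecidableEq n] (R : Matrix n n ℝ) : Prop :=
  ∃ Q : Matrix n n ℝ, (∀ i j, 0 ≤ Q i j) ∧ (∀ i, Q i i = 0) ∧
    spectralRadius ℂ (Q.map (algebraMap ℝ ℂ)) < 1 ∧ R = 1 - Q

/-- `Z` (with boundary terms `L`) solves the Skorohod problem in the orthant `ℝ_+^d`
with reflection matrix `R` and driving function `X`. -/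
def IsSkorohodSolution {d : ℕ} (R : Matrix (Fin d) (Fin d) ℝ)
    (X Z L : ℝ → Fin d → ℝ) : Prop :=
  (∀ i, Continuous fun t => Z t i) ∧
  (∀ i, Continuous fun t => L t i) ∧
  (∀ t, 0 ≤ t → ∀ i, 0 ≤ Z t i) ∧
  (∀ t, 0 ≤ t → ∀ i, Z t i = X t i + ∑ j, R i j * L t j) ∧
  (∀ i, L 0 i = 0) ∧
  (∀ i, MonotoneOn (fun t => L t i) (Ici 0)) ∧
  (∀ i, ∀ s t : ℝ, 0 ≤ s → s ≤ t → (∀ u ∈ Icc s t, Z u i ≠ 0) → L t i = L s i)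

/-- The tridiagonal reflection matrix of the gap process: `1` on the diagonal,
`−q_{k+1}^-` on the superdiagonal, `−q_{k+1}^+` on the subdiagonal
(in `0`-indexed notation: row `i`, column `i+1` is `−qm (i+1)`; row `i`, column `i−1`
is `−qp i`). -/
def gapReflectionMatrix (N : ℕ) (qp qm : Fin N → ℝ) :
    Matrix (Fin (N - 1)) (Fin (N - 1)) ℝ := fun i j =>
  if i = j then 1
  else if (j : ℕ) = (i : ℕ) + 1 then -qm ⟨(j : ℕ), by have := j.isLt; omega⟩
  else if (i : ℕ) = (j : ℕ) + 1 then -qp ⟨(i : ℕ), by have := i.isLt; omega⟩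
  else 0

theorem aux_sum_eq {d : ℕ} (g : Fin d → ℝ) (m : ℕ) :
    ∑ j : Fin d, (if (j : ℕ) = m then g j else 0) = if h : m < d then g ⟨m, h⟩ else 0 := by
  split_ifs with h
  · rw [Finset.sum_eq_single ⟨m, h⟩]
    · simp
    · intro b _ hb
      rw [if_neg]
      intro hh
      exact hb (Fin.ext hh)
    · simp
  · apply Finset.sum_eq_zero
    intro j _
    rw [if_neg]
    have := j.isLt
    omega

theorem aux_sum_succ {d : ℕ} (g : Fin d → ℝ) (m : ℕ) :
    ∑ j : Fin d, (if m = (j : ℕ) + 1 then g j else 0)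
      = if h : 1 ≤ m ∧ m - 1 < d then g ⟨m - 1, h.2⟩ else 0 := by
  split_ifs with h
  · rw [← (by rw [dif_pos h.2] :
      (if h : m - 1 < d then g ⟨m - 1, h⟩ else 0) = g ⟨m - 1, h.2⟩), ← aux_sum_eq]
    apply Finset.sum_congr rfl
    intro j _
    have : (m = (j : ℕ) + 1) ↔ ((j : ℕ) = m - 1) := by omega
    simp only [this]
  · apply Finset.sum_eq_zero
    intro j _
    rw [if_neg]
    have := j.isLt
    omega

theorem aux_spec {d : ℕ} (Q : Matrix (Fin d) (Fin d) ℝ) (hQ : ∀ i j, 0 ≤ Q i j)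
    (w : Fin d → ℝ) (hw : ∀ i, 0 < w i) (hwQ : ∀ j, ∑ i, w i * Q i j < w j) :
    spectralRadius ℂ (Q.map (algebraMap ℝ ℂ)) < 1 := by
  have key : ∀ k ∈ spectrum ℂ (Q.map (algebraMap ℝ ℂ)), ‖k‖ < 1 := by
    intro k hk
    rw [← Matrix.spectrum_toLin', ← Module.End.hasEigenvalue_iff_mem_spectrum] at hk
    obtain ⟨v, hv⟩ := hk.exists_hasEigenvector
    have hv0 := hv.2
    have hv1 := hv.apply_eq_smul
    have h1 : ∀ i, ‖k‖ * ‖v i‖ ≤ ∑ j, Q i j * ‖v j‖ := by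
      intro i
      have := congrFun hv1 i
      simp only [Matrix.toLin'_apply, Matrix.mulVec, dotProduct, Pi.smul_apply, smul_eq_mul,
        Matrix.map_apply] at this
      rw [← norm_mul, ← this]
      refine (norm_sum_le _ _).trans (Finset.sum_le_sum fun j _ => ?_)
      rw [norm_mul]
      simp [abs_of_nonneg (hQ i j)]
    have h2 : ‖k‖ * ∑ i, w i * ‖v i‖ ≤ ∑ j, (∑ i, w i * Q i j) * ‖v j‖ := by
      simp only [Finset.mul_sum, Finset.sum_mul]
      rw [Finset.sum_comm]
      refine Finset.sum_le_sum fun i _ => ?_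
      have := mul_le_mul_of_nonneg_left (h1 i) (hw i).le
      rw [Finset.mul_sum] at this
      calc _ = w i * (‖k‖ * ‖v i‖) := by ring
        _ ≤ _ := this
        _ = _ := Finset.sum_congr rfl fun j _ => by ring
    obtain ⟨i₀, hi₀⟩ := Function.ne_iff.mp hv0
    have hi₁ : 0 < ‖v i₀‖ := norm_pos_iff.mpr hi₀
    have h3 : ∑ j, (∑ i, w i * Q i j) * ‖v j‖ < ∑ j, w j * ‖v j‖ := by
      apply Finset.sum_lt_sum
      · intro j _
        exact mul_le_mul_of_nonneg_right (hwQ j).le (norm_nonneg _)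
      · exact ⟨i₀, Finset.mem_univ _, mul_lt_mul_of_pos_right (hwQ i₀) hi₁⟩
    have h4 : 0 ≤ ∑ i, w i * ‖v i‖ :=
      Finset.sum_nonneg fun i _ => mul_nonneg (hw i).le (norm_nonneg _)
    by_contra hc
    push Not at hc
    nlinarith
  have hfin : (spectrum ℂ (Q.map (algebraMap ℝ ℂ))).Finite := Matrix.finite_spectrum _
  unfold spectralRadius
  have : (⨆ k ∈ spectrum ℂ (Q.map (algebraMap ℝ ℂ)), (‖k‖₊ : ENNReal))
      = hfin.toFinset.sup fun k => (‖k‖₊ : ENNReal) := by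
    rw [Finset.sup_eq_iSup]
    simp
  rw [this, Finset.sup_lt_iff (by simp)]
  intro k hk
  have := key k (by simpa using hk)
  exact_mod_cast this

theorem aux_M (N : ℕ) (hN : 2 ≤ N) (qp qm : Fin N → ℝ)
    (hq : ∀ k, 0 < qp k ∧ qp k < 1 ∧ 0 < qm k ∧ qm k < 1)
    (hrel : ∀ (k : Fin N) (hk : (k : ℕ) + 1 < N), qp ⟨(k : ℕ) + 1, hk⟩ + qm k = 1) :
    IsReflMMatrix (gapReflectionMatrix N qp qm) := by
  refine ⟨1 - gapReflectionMatrix N qp qm, ?_, ?_, ?_, by simp⟩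
  · intro i j
    simp only [Matrix.sub_apply, Matrix.one_apply, gapReflectionMatrix]
    split_ifs
    · simp
    · simpa using (hq _).2.2.1.le
    · simpa using (hq _).1.le
    · simp
  · intro i
    simp [gapReflectionMatrix]
  · have : Nonempty (Fin N) := ⟨⟨0, by omega⟩⟩
    obtain ⟨k₀, hk₀⟩ := Finite.exists_min qm
    obtain ⟨ε, hε⟩ : ∃ ε, ε = qm k₀ := ⟨_, rfl⟩
    have hε0 : 0 < ε := hε ▸ (hq k₀).2.2.1
    apply aux_spec _ _ (fun i => ∑ n ∈ Finset.range ((i : ℕ) + 1), ε ^ n)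
    · intro i
      exact Finset.sum_pos (fun n _ => pow_pos hε0 n) ⟨0, by simp⟩
    · intro j
      have hj := j.isLt
      have hpt : ∀ i : Fin (N - 1), (∑ n ∈ Finset.range ((i : ℕ) + 1), ε ^ n) *
          (1 - gapReflectionMatrix N qp qm) i j =
          (if (j : ℕ) = (i : ℕ) + 1 then
            (∑ n ∈ Finset.range ((i : ℕ) + 1), ε ^ n) * qm ⟨j, by omega⟩ else 0) +
          (if (i : ℕ) = (j : ℕ) + 1 then
            (∑ n ∈ Finset.range ((i : ℕ) + 1), ε ^ n) * qp ⟨(j : ℕ) + 1, by omega⟩ else 0) := by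
        intro i
        simp only [Matrix.sub_apply, Matrix.one_apply, gapReflectionMatrix]
        by_cases h1 : i = j
        · subst h1; simp
        · by_cases h2 : (j : ℕ) = (i : ℕ) + 1
          · have h3 : ¬ ((i : ℕ) = (j : ℕ) + 1) := by omega
            rw [if_neg h1, if_neg h1, if_pos h2, if_pos h2, if_neg h3]; ring
          · by_cases h3 : (i : ℕ) = (j : ℕ) + 1
            · rw [if_neg h1, if_neg h1, if_neg h2, if_pos h3, if_neg h2, if_pos h3]; simp [h3]
            · simp [h1, h2, h3]
      rw [Finset.sum_congr rfl fun i _ => hpt i, Finset.sum_add_distrib, aux_sum_succ,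
        aux_sum_eq]
      have hr := hrel ⟨j, by omega⟩ (by simp; omega)
      have hm := hq ⟨j, by omega⟩
      have hp := hq ⟨(j : ℕ) + 1, by omega⟩
      have hmin := hk₀ ⟨j, by omega⟩
      rw [← hε] at hmin
      simp only at hr
      generalize qm ⟨j, by omega⟩ = a at *
      generalize qp ⟨(j : ℕ) + 1, by omega⟩ = b at *
      have hS : 0 ≤ ∑ n ∈ Finset.range (j : ℕ), ε ^ n :=
        Finset.sum_nonneg fun n _ => (pow_pos hε0 n).le
      have hpow : 0 < ε ^ (j : ℕ) := pow_pos hε0 _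
      have hA : (if h : 1 ≤ (j : ℕ) ∧ (j : ℕ) - 1 < N - 1 then
          (∑ n ∈ Finset.range ((j : ℕ) - 1 + 1), ε ^ n) * a else 0)
          = (∑ n ∈ Finset.range (j : ℕ), ε ^ n) * a := by
        split_ifs with h
        · rw [Nat.sub_add_cancel h.1]
        · have : (j : ℕ) = 0 := by omega
          simp [this]
      have hB : (if h : (j : ℕ) + 1 < N - 1 then
          (∑ n ∈ Finset.range ((j : ℕ) + 1 + 1), ε ^ n) * b else 0)
          ≤ (∑ n ∈ Finset.range ((j : ℕ) + 1 + 1), ε ^ n) * b := by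
        split_ifs with h
        · exact le_rfl
        · exact mul_nonneg (Finset.sum_nonneg fun n _ => (pow_pos hε0 n).le) hp.1.le
      refine (add_le_add hA.le hB).trans_lt ?_
      rw [Finset.sum_range_succ, Finset.sum_range_succ, pow_succ]
      generalize (∑ n ∈ Finset.range (j : ℕ), ε ^ n) = S at *
      generalize ε ^ (j : ℕ) = p at *
      have hb : b = 1 - a := by linarith
      have h5 : ε * b < a := by nlinarith
      have h6 : p * (ε * b) < p * a := mul_lt_mul_of_pos_left h5 hpow
      subst hb
      nlinarith
    · intro i j
      simp only [Matrix.sub_apply, Matrix.one_apply, gapReflectionMatrix]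
      split_ifs
      · simp
      · simpa using (hq _).2.2.1.le
      · simpa using (hq _).1.le
      · simp

/-- The gap process `Z_k = Y_{k+1} − Y_k` of a system of competing particles solves the
Skorohod problem in `ℝ_+^{N−1}` with driving function `(X_2 − X_1, …, X_N − X_{N−1})` and
the tridiagonal reflection matrix `R`; moreover `R` is a reflection nonsingular M-matrix. -/
theorem stmt13 (N : ℕ) (hN : 2 ≤ N) (qp qm : Fin N → ℝ)
    (hq : ∀ k, 0 < qp k ∧ qp k < 1 ∧ 0 < qm k ∧ qm k < 1)
    (hrel : ∀ (k : Fin N) (hk : (k : ℕ) + 1 < N), qp ⟨(k : ℕ) + 1, hk⟩ + qm k = 1)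
    (X Y : ℝ → Fin N → ℝ) (L : ℝ → Fin (N + 1) → ℝ)
    (hX : ∀ k, Continuous fun t => X t k) (hX0 : Monotone (X 0))
    (h : IsCompetingParticleSystem N qp qm X Y L) :
    IsSkorohodSolution (gapReflectionMatrix N qp qm)
      (fun t i => X t ⟨(i : ℕ) + 1, by have := i.isLt; omega⟩
                  - X t ⟨(i : ℕ), by have := i.isLt; omega⟩)
      (fun t i => Y t ⟨(i : ℕ) + 1, by have := i.isLt; omega⟩
                  - Y t ⟨(i : ℕ), by have := i.isLt; omega⟩)
      (fun t i => L t ⟨(i : ℕ) + 1, by have := i.isLt; omega⟩) ∧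
    IsReflMMatrix (gapReflectionMatrix N qp qm) := by
  refine ⟨?_, aux_M N hN qp qm hq hrel⟩
  obtain ⟨hY, hL, hmono, hbd, heq, hL0, hLm, hcol⟩ := h
  refine ⟨fun i => (hY _).sub (hY _), fun i => hL _, ?_, ?_, fun i => hL0 _, fun i => hLm _, ?_⟩
  · intro t ht i
    exact sub_nonneg.mpr (hmono t ht (by simp [Fin.le_def]))
  · intro t ht i
    have hi := i.isLt
    have hpt : ∀ j : Fin (N - 1), gapReflectionMatrix N qp qm i j *
          L t ⟨(j : ℕ) + 1, by have := j.isLt; omega⟩ =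
        ((if (j : ℕ) = (i : ℕ) then L t ⟨(j : ℕ) + 1, by have := j.isLt; omega⟩ else 0) +
        (if (j : ℕ) = (i : ℕ) + 1 then -qm ⟨(i : ℕ) + 1, by omega⟩ *
          L t ⟨(j : ℕ) + 1, by have := j.isLt; omega⟩ else 0)) +
        (if (i : ℕ) = (j : ℕ) + 1 then -qp ⟨(i : ℕ), by omega⟩ *
          L t ⟨(j : ℕ) + 1, by have := j.isLt; omega⟩ else 0) := by
      intro j
      simp only [gapReflectionMatrix]
      by_cases h1 : i = j
      · subst h1; simp
      · have h1' : ¬ ((j : ℕ) = (i : ℕ)) := fun hh => h1 (Fin.ext hh.symm)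
        by_cases h2 : (j : ℕ) = (i : ℕ) + 1
        · have h3 : ¬ ((i : ℕ) = (j : ℕ) + 1) := by omega
          rw [if_neg h1, if_neg h1', if_pos h2, if_neg h3, if_pos h2]; simp [h2]
        · by_cases h3 : (i : ℕ) = (j : ℕ) + 1
          · simp only [if_neg h1, if_neg h1', if_neg h2, if_pos h3]; ring
          · simp [h1, h1', h2, h3]
    rw [Finset.sum_congr rfl fun j _ => hpt j, Finset.sum_add_distrib, Finset.sum_add_distrib,
      aux_sum_succ, aux_sum_eq, aux_sum_eq]
    have hA : (if h : (i : ℕ) + 1 < N - 1 then -qm ⟨(i : ℕ) + 1, by omega⟩ *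
          L t ⟨(i : ℕ) + 1 + 1, by omega⟩ else 0) =
          -qm ⟨(i : ℕ) + 1, by omega⟩ * L t ⟨(i : ℕ) + 1 + 1, by omega⟩ := by
      split_ifs with h
      · rfl
      · have : (⟨(i : ℕ) + 1 + 1, by omega⟩ : Fin (N + 1)) = Fin.last N := by
          apply Fin.ext; simp; omega
        rw [this, (hbd t).2]; simp
    have hB : (if h : 1 ≤ (i : ℕ) ∧ (i : ℕ) - 1 < N - 1 then -qp ⟨(i : ℕ), by omega⟩ *
          L t ⟨(i : ℕ) - 1 + 1, by omega⟩ else 0) =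
          -qp ⟨(i : ℕ), by omega⟩ * L t ⟨(i : ℕ), by omega⟩ := by
      split_ifs with h
      · simp only [Nat.sub_add_cancel h.1]
      · have : (⟨(i : ℕ), by omega⟩ : Fin (N + 1)) = 0 := by
          apply Fin.ext; simp; omega
        rw [this, (hbd t).1]; simp
    rw [dif_pos hi]
    refine Eq.trans ?_ (congrArg₂ (fun x y => _ + (L t ⟨(i : ℕ) + 1, by omega⟩ + x + y))
      hA.symm hB.symm)
    have e1 := heq t ht ⟨(i : ℕ) + 1, by omega⟩
    have e2 := heq t ht ⟨(i : ℕ), by omega⟩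
    have hr := hrel ⟨(i : ℕ), by omega⟩ (by simp; omega)
    simp only [Fin.castSucc_mk, Fin.succ_mk] at e1 e2 hr
    beta_reduce
    rw [e1, e2]
    linear_combination (L t ⟨(i : ℕ) + 1, by omega⟩) * hr
  · intro i s t hs hst hne
    have hi := i.isLt
    refine hcol ⟨(i : ℕ), by omega⟩ (by simp; omega) s t hs hst ?_
    intro u hu he
    exact hne u hu (sub_eq_zero.mpr he.symm)
end
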